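/- Let f and g be continuous real-valued functions on S³, odd with respect to 𝒪, and ζ ∈ S³. Assume that for every w ∈ S²(ζ), neither f nor g has a (ζ, π)-rotational symmetry on S²(w), nor a (u, π)-rotational symmetry on S²(w) for any u ∈ S²(ζ) ∩ S²(w), and assume S²(ζ) = Ψ, i.e. for every w ∈ S²(ζ) there exists a rotation φ_w ∈ SO(3, S²(w)) with φ_w(ζ) = −ζ and f∘φ_w = g on S²(w). Then for every w ∈ S²(ζ) this rotation is unique: there is exactly one rotation φ_w ∈ SO(3, S²(w)), necessarily a rotation by the angle π around some u ∈ S²(w) ∩ S²(ζ), satisfying f∘φ_w = g on S²(w). -/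

import Mathlib

noncomputable section

open scoped RealInnerProductSpace

/-- `ℝ⁴` as a Euclidean space. -/
abbrev E4 := EuclideanSpace ℝ (Fin 4)

/-- The unit sphere `S³` in `ℝ⁴`. -/
def sph : Set E4 := Metric.sphere (0 : E4) 1

/-- The great subsphere `S²(w) = {θ ∈ S³ : θ·w = 0}`. -/
def S2 (w : E4) : Set E4 := {θ ∈ sph | ⟪θ, w⟫ = 0}

/-- The orthogonal transformation `𝒪` determined by `ζ`: for a unit vector `ζ` the map
`x ↦ 2⟪x,ζ⟫ζ - x` satisfies `𝒪 ζ = ζ` and `𝒪 = -I` on `ζ^⊥`. -/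
def Ocal (ζ x : E4) : E4 := (2 * ⟪x, ζ⟫) • ζ - x

/-- `φ` is (the extension to `ℝ⁴` of) an element of `SO(3, S²(w))`:
a linear isometry of `ℝ⁴` fixing `w`, of determinant `1`, i.e. a rotation
of the `3`-dimensional subspace `w^⊥`. -/
def IsRot (w : E4) (φ : E4 ≃ₗᵢ[ℝ] E4) : Prop :=
  φ w = w ∧ LinearMap.det (φ.toLinearEquiv : E4 →ₗ[ℝ] E4) = 1

/-- `φ ∈ SO(3, S²(w))` is a rotation by the angle `α·π` around the axis `u ∈ S²(w)`:
it fixes `w` and `u`, and turns the plane orthogonal to `w` and `u` by the angle `α·π`. -/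
def IsRotAngleAbout (w u : E4) (α : ℝ) (φ : E4 ≃ₗᵢ[ℝ] E4) : Prop :=
  IsRot w φ ∧ φ u = u ∧
    ∀ v : E4, ⟪v, w⟫ = 0 → ⟪v, u⟫ = 0 →
      ⟪φ v, v⟫ = Real.cos (α * Real.pi) * ⟪v, v⟫

/-- The function `f` has a `(u, π)`-rotational symmetry on `S²(ξ)`:
`f ∘ φ = f` on `S²(ξ)` for the rotation `φ ∈ SO(3, S²(ξ))` by the angle `π` about `u`. -/
def HasPiRotSym (f : E4 → ℝ) (ξ u : E4) : Prop :=
  ∃ φ : E4 ≃ₗᵢ[ℝ] E4, IsRotAngleAbout ξ u 1 φ ∧ ∀ θ ∈ S2 ξ, f (φ θ) = f θ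

open Real

/-- A closed family of subgroups of `ℝ` over a compact space, all containing `2π` and none
containing `π`, is uniformly contained in some `(2π/N)ℤ`. -/
lemma exists_uniform_period {X : Type*} [TopologicalSpace X] [CompactSpace X]
    (H : X → AddSubgroup ℝ) (hcl : IsClosed {q : X × ℝ | q.2 ∈ H q.1})
    (h2 : ∀ x, 2 * π ∈ H x) (h1 : ∀ x, π ∉ H x) :
    ∃ N : ℕ, 0 < N ∧ ∀ x, ∀ δ ∈ H x, ∃ k : ℤ, N * δ = k * (2 * π) := by
  obtain ⟨U, V, -, hV, hU, hπ, hUV⟩ := generalized_tube_lemma (isCompact_univ (X := X))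
    (isCompact_singleton (x := π)) hcl.isOpen_compl (by
      rintro ⟨x, y⟩ ⟨-, hy⟩
      obtain rfl : y = π := hy
      exact h1 x)
  obtain ⟨ε, hε, hball⟩ := Metric.isOpen_iff.1 hV π (hπ rfl)
  have hsmall : ∀ x, ∀ δ ∈ H x, 0 < δ → ε ≤ δ := by
    intro x δ hδ hpos
    by_contra! hlt
    have hmem : (⌊π / δ⌋ : ℤ) • δ ∈ H x := AddSubgroup.zsmul_mem _ hδ _
    have hmul : π / δ * δ = π := by field_simp
    have hle : (⌊π / δ⌋ : ℝ) * δ ≤ π := by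
      nlinarith [Int.floor_le (π / δ)]
    have hge : π < (⌊π / δ⌋ : ℝ) * δ + δ := by
      nlinarith [Int.lt_floor_add_one (π / δ)]
    refine hUV (a := (x, (⌊π / δ⌋ : ℤ) • δ)) ⟨hU (Set.mem_univ x), hball ?_⟩ hmem
    rw [Metric.mem_ball, Real.dist_eq, zsmul_eq_mul, abs_lt]
    constructor <;> linarith
  obtain ⟨n, hn⟩ := exists_nat_gt (2 * π / ε)
  have hn0 : 0 < n := by
    have : (0 : ℝ) < n := lt_trans (by positivity) hn
    exact_mod_cast this
  refine ⟨n.factorial, n.factorial_pos, fun x δ hδ => ?_⟩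
  obtain ⟨j, k, hk0, hkn, hjk⟩ := Real.exists_int_int_abs_mul_sub_le (δ / (2 * π)) hn0
  have hη : k • δ - j • (2 * π) ∈ H x :=
    sub_mem (AddSubgroup.zsmul_mem _ hδ _) (AddSubgroup.zsmul_mem _ (h2 x) _)
  have hηlt : |k • δ - j • (2 * π)| < ε := by
    have e : k • δ - j • (2 * π) = (k * (δ / (2 * π)) - j) * (2 * π) := by
      simp only [zsmul_eq_mul]
      field_simp
    rw [e, abs_mul, abs_of_pos (by positivity : 0 < 2 * π)]
    rw [div_lt_iff₀ hε] at hn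
    calc _ ≤ 1 / ((n : ℝ) + 1) * (2 * π) := by gcongr
      _ < ε := by
        rw [one_div, inv_mul_lt_iff₀ (by positivity)]
        linarith
  have hη0 : k • δ - j • (2 * π) = 0 := by
    by_contra hne
    rcases abs_choice (k • δ - j • (2 * π)) with h | h
    · exact absurd (hsmall x _ (h.symm ▸ hη) (abs_pos.2 hne)) (not_le.2 hηlt)
    · exact absurd (hsmall x _ (h.symm ▸ neg_mem hη) (abs_pos.2 hne)) (not_le.2 hηlt)
  lift k to ℕ using hk0.le
  obtain ⟨m, hm⟩ := Nat.dvd_factorial (by exact_mod_cast hk0) (by exact_mod_cast hkn : k ≤ n)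
  refine ⟨m * j, ?_⟩
  simp only [zsmul_eq_mul, Int.cast_natCast] at hη0
  rw [hm]
  push_cast
  linear_combination (m : ℝ) * hη0

/-- A closed multivalued angle on a space `X`, well defined up to `(2π/N)ℤ`, has a continuous
`N`-th power with values in the circle. -/
lemma exists_continuous_power {X : Type*} [TopologicalSpace X]
    (Γ : X → Set ℝ) (hcl : IsClosed {q : X × ℝ | q.2 ∈ Γ q.1}) (hne : ∀ x, (Γ x).Nonempty)
    (hper : ∀ x, ∀ γ ∈ Γ x, ∀ k : ℤ, γ + k * (2 * π) ∈ Γ x) (N : ℕ)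
    (hN : ∀ x, ∀ γ ∈ Γ x, ∀ γ' ∈ Γ x, ∃ k : ℤ, N * (γ - γ') = k * (2 * π)) :
    ∃ Z : X → Circle, Continuous Z ∧ ∀ x, ∀ γ ∈ Γ x, Z x = Circle.exp (N * γ) := by
  choose c hc using hne
  have hZ : ∀ x, ∀ γ ∈ Γ x, Circle.exp (N * c x) = Circle.exp (N * γ) := by
    intro x γ hγ
    obtain ⟨k, hk⟩ := hN x _ (hc x) γ hγ
    rw [Circle.exp_eq_exp]
    exact ⟨k, by linear_combination hk⟩
  refine ⟨fun x => Circle.exp (N * c x), ?_, hZ⟩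
  rw [continuous_iff_isClosed]
  intro A hA
  let S : Set (X × Set.Icc (0 : ℝ) (2 * π)) :=
    {q | (q.2 : ℝ) ∈ Γ q.1 ∧ Circle.exp (N * (q.2 : ℝ)) ∈ A}
  have hS : IsClosed S := by
    refine IsClosed.inter (hcl.preimage (f := fun q : X × Set.Icc (0 : ℝ) (2 * π) =>
      (q.1, (q.2 : ℝ))) (by fun_prop)) (hA.preimage (f := fun q : X × Set.Icc (0 : ℝ) (2 * π) =>
      Circle.exp (N * (q.2 : ℝ))) (by fun_prop))
  convert isClosedMap_fst_of_compactSpace S hS using 1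
  ext x
  constructor
  · intro hx
    have hmem := hper x _ (hc x) (-⌊c x / (2 * π)⌋)
    have hmul : c x / (2 * π) * (2 * π) = c x := by field_simp
    refine ⟨(x, ⟨c x + ((-⌊c x / (2 * π)⌋ : ℤ) : ℝ) * (2 * π), ?_, ?_⟩), ⟨hmem, ?_⟩, rfl⟩
    · push_cast
      nlinarith [Int.floor_le (c x / (2 * π)), pi_pos]
    · push_cast
      nlinarith [Int.lt_floor_add_one (c x / (2 * π)), pi_pos]
    · rw [← hZ x _ hmem]
      exact hx
  · rintro ⟨⟨x, y⟩, ⟨hy, hyA⟩, rfl⟩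
    simpa only [Set.mem_preimage, hZ x _ hy] using hyA

/-- Loops in the circle of nonzero opposite winding numbers are not homotopic. -/
lemma no_homotopy_of_opposite_winding (Z : ℝ × ℝ → Circle) (hZ : Continuous Z)
    (hper : ∀ s, Z (s, 2 * π) = Z (s, 0)) (M : ℝ) (hM : M ≠ 0)
    (h0 : ∀ θ, Z (0, θ) = Z (0, 0) * Circle.exp (-(M * θ)))
    (h1 : ∀ θ, Z (π, θ) = Z (π, 0) * Circle.exp (M * θ)) : False := by
  obtain ⟨e, he⟩ := Circle.exp_surjective (Z (0, 0))
  obtain ⟨L, ⟨-, hL⟩, -⟩ := Circle.isCoveringMap_exp.existsUnique_continuousMap_lifts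
    ⟨Z, hZ⟩ (0, 0) e he
  have hL' : ∀ x, Circle.exp (L x) = Z x := fun x => congrFun hL x
  have key : ∀ u : ℝ → ℝ, Continuous u → (∀ x y, Circle.exp (u x) = Circle.exp (u y)) →
      ∀ x y, u x = u y := by
    intro u hu hexp x y
    have hloc : Continuous fun x => (u x - u y) / (2 * π) := by fun_prop
    have hint : ∀ x, ∃ k : ℤ, (k : ℝ) = (u x - u y) / (2 * π) := by
      intro x
      obtain ⟨k, hk⟩ := Circle.exp_eq_exp.1 (hexp x y)
      exact ⟨k, by rw [hk]; field_simp; ring⟩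
    choose k hk using hint
    have hkc : Continuous k := by
      rw [Int.isClosedEmbedding_coe_real.isInducing.continuous_iff]
      convert hloc using 1
      exact funext hk
    have hxy := PreconnectedSpace.constant inferInstance hkc (x := x) (y := y)
    have hx := hk x
    rw [hxy, hk y, sub_self, zero_div] at hx
    have : u x - u y = 0 := by
      by_contra hne
      exact (div_ne_zero hne (by positivity : 2 * π ≠ 0)) hx.symm
    linarith
  have d := key (fun s => L (s, 2 * π) - L (s, 0)) (by fun_prop) (by
    intro x y
    simp [Circle.exp_sub, hL', hper]) 0 π
  have d0 := key (fun θ => L (0, θ) + M * θ) (by fun_prop) (by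
    intro x y
    simp only [Circle.exp_add, hL']
    rw [h0 x, h0 y, Circle.exp_neg, Circle.exp_neg]
    simp) (2 * π) 0
  have d1 := key (fun θ => L (π, θ) - M * θ) (by fun_prop) (by
    intro x y
    simp only [Circle.exp_sub, hL']
    rw [h1 x, h1 y]
    simp) (2 * π) 0
  have : M * (2 * π) = 0 := by linarith
  exact (mul_ne_zero hM (by positivity)) this

/-- The point of `S³` with polar angle `t` from `ζ` and longitude `α` in the plane of `a`, `b`. -/
def polarPoint (ζ : E4) (p : E4 × E4) (t α : ℝ) : E4 :=
  cos t • ζ + sin t • (cos α • p.1 + sin α • p.2)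

/-- Orthonormal pairs in `ζ^⊥`. -/
def frames (ζ : E4) : Set (E4 × E4) :=
  {p | ‖p.1‖ = 1 ∧ ‖p.2‖ = 1 ∧ ⟪p.1, p.2⟫ = 0 ∧ ⟪ζ, p.1⟫ = 0 ∧ ⟪ζ, p.2⟫ = 0}

lemma isCompact_frames (ζ : E4) : IsCompact (frames ζ) := by
  refine Metric.isCompact_of_isClosed_isBounded ?_ ?_
  · simp only [frames, Set.ofPred_and]
    refine IsClosed.inter ?_ (IsClosed.inter ?_ (IsClosed.inter ?_ (IsClosed.inter ?_ ?_))) <;>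
      exact isClosed_eq (by fun_prop) (by fun_prop)
  · refine (Metric.isBounded_closedBall (x := (0 : E4 × E4)) (r := 1)).subset ?_
    rintro p ⟨h1, h2, -⟩
    simp [Prod.norm_def, h1, h2]

lemma exists_basis {ζ : E4} (hζ : ‖ζ‖ = 1) {p : E4 × E4} (hp : p ∈ frames ζ) :
    ∃ B : OrthonormalBasis (Fin 4) ℝ E4, B 0 = ζ ∧ B 1 = p.1 ∧ B 2 = p.2 := by
  obtain ⟨h1, h2, h12, h01, h02⟩ := hp
  have ho : Orthonormal ℝ (({0, 1, 2} : Set (Fin 4)).domRestrict ![ζ, p.1, p.2, 0]) := by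
    refine ⟨?_, ?_⟩
    · rintro ⟨i, hi⟩
      simp only [Set.mem_insert_iff, Set.mem_singleton_iff] at hi
      rcases hi with rfl | rfl | rfl <;> simpa [Set.domRestrict]
    · rintro ⟨i, hi⟩ ⟨j, hj⟩ hij
      fin_cases i <;> fin_cases j <;> simp_all [Set.domRestrict, real_inner_comm]
  obtain ⟨B, hB⟩ := ho.exists_orthonormalBasis_extension_of_card_eq (by simp)
  exact ⟨B, hB 0 (by simp), hB 1 (by simp), hB 2 (by simp)⟩

lemma polarPoint_mem_sph {ζ : E4} (hζ : ‖ζ‖ = 1) {p : E4 × E4} (hp : p ∈ frames ζ) (t α : ℝ) :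
    polarPoint ζ p t α ∈ sph := by
  obtain ⟨h1, h2, h12, h01, h02⟩ := hp
  have h21 : ⟪p.2, p.1⟫ = 0 := by rw [real_inner_comm, h12]
  have h10 : ⟪p.1, ζ⟫ = 0 := by rw [real_inner_comm, h01]
  have h20 : ⟪p.2, ζ⟫ = 0 := by rw [real_inner_comm, h02]
  have : ‖polarPoint ζ p t α‖ ^ 2 = 1 := by
    rw [← real_inner_self_eq_norm_sq]
    simp only [polarPoint, inner_add_left, inner_add_right, real_inner_smul_left,
      real_inner_smul_right]
    simp only [h12, h01, h02, h21, h10, h20, real_inner_self_eq_norm_sq, h1, h2, hζ]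
    linear_combination sin_sq_add_cos_sq t + sin t ^ 2 * sin_sq_add_cos_sq α
  rw [sph, mem_sphere_zero_iff_norm]
  nlinarith [norm_nonneg (polarPoint ζ p t α)]

lemma exists_polarPoint (B : OrthonormalBasis (Fin 4) ℝ E4) {x : E4} (hx : x ∈ S2 (B 3)) :
    ∃ t α, x = polarPoint (B 0) (B 1, B 2) t α := by
  obtain ⟨hx1, hx3⟩ := hx
  rw [sph, mem_sphere_zero_iff_norm] at hx1
  rw [real_inner_comm] at hx3
  have hexp := B.sum_repr' x
  have hsq := B.sum_sq_inner_right x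
  rw [Fin.sum_univ_four, hx3] at hexp hsq
  rw [hx1] at hsq
  set x0 := ⟪B 0, x⟫
  set z : ℂ := ⟨⟪B 1, x⟫, ⟪B 2, x⟫⟩ with hz
  have hzn : ‖z‖ ^ 2 = 1 - x0 ^ 2 := by
    rw [← Complex.normSq_eq_norm_sq, Complex.normSq_mk]
    linarith
  have hs : sin (arccos x0) = ‖z‖ := by
    rw [sin_arccos, ← hzn, sqrt_sq (norm_nonneg z)]
  have hc : cos (arccos x0) = x0 :=
    cos_arccos (by nlinarith [sq_nonneg ‖z‖]) (by nlinarith [sq_nonneg ‖z‖])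
  refine ⟨arccos x0, z.arg, ?_⟩
  rw [polarPoint, hs, hc, smul_add, smul_smul, smul_smul, Complex.norm_mul_cos_arg,
    Complex.norm_mul_sin_arg, ← hexp]
  simp [hz, add_assoc]

lemma exists_angle_of_isRot (B : OrthonormalBasis (Fin 4) ℝ E4) (φ : E4 ≃ₗᵢ[ℝ] E4)
    (hφ : IsRot (B 3) φ) (h0 : φ (B 0) = -B 0) :
    ∃ γ, φ (B 1) = cos γ • B 1 + sin γ • B 2 ∧ φ (B 2) = sin γ • B 1 - cos γ • B 2 := by
  obtain ⟨h3, hdet⟩ := hφ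
  have hin : ∀ i j, ⟪φ (B i), φ (B j)⟫ = if i = j then (1 : ℝ) else 0 := by
    intro i j
    rw [φ.inner_map_map, orthonormal_iff_ite.1 B.orthonormal]
  have z01 : ⟪B 0, φ (B 1)⟫ = 0 := by have := hin 0 1; rw [h0] at this; simpa using this
  have z02 : ⟪B 0, φ (B 2)⟫ = 0 := by have := hin 0 2; rw [h0] at this; simpa using this
  have z31 : ⟪B 3, φ (B 1)⟫ = 0 := by have := hin 3 1; rw [h3] at this; simpa using this
  have z32 : ⟪B 3, φ (B 2)⟫ = 0 := by have := hin 3 2; rw [h3] at this; simpa using this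
  have e1 := B.sum_repr' (φ (B 1))
  have e2 := B.sum_repr' (φ (B 2))
  have s1 := B.sum_sq_inner_right (φ (B 1))
  have s2 := B.sum_sq_inner_right (φ (B 2))
  rw [Fin.sum_univ_four, z01, z31] at e1 s1
  rw [Fin.sum_univ_four, z02, z32] at e2 s2
  rw [φ.norm_map, B.norm_eq_one] at s1 s2
  have hentry : ∀ i j, LinearMap.toMatrix B.toBasis B.toBasis
      (φ.toLinearEquiv : E4 →ₗ[ℝ] E4) i j = ⟪B i, φ (B j)⟫ := by
    intro i j
    rw [LinearMap.toMatrix_apply]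
    simp [B.repr_apply_apply]
  have hB : ∀ i j, ⟪B i, B j⟫ = if i = j then (1 : ℝ) else 0 :=
    orthonormal_iff_ite.1 B.orthonormal
  rw [← LinearMap.det_toMatrix B.toBasis, Matrix.det_succ_row_zero] at hdet
  simp [Fin.sum_univ_four, Matrix.det_fin_three, hentry, h0, h3, hB, z01, z02, z31, z32,
    Fin.succAbove] at hdet
  set p := ⟪B 1, φ (B 1)⟫
  set q := ⟪B 2, φ (B 1)⟫
  set r := ⟪B 1, φ (B 2)⟫
  set s := ⟪B 2, φ (B 2)⟫
  have hsum : (p + s) ^ 2 + (q - r) ^ 2 = 0 := by linarith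
  have hs : s = -p := by nlinarith [sq_nonneg (p + s), sq_nonneg (q - r)]
  have hr : r = q := by nlinarith [sq_nonneg (p + s), sq_nonneg (q - r)]
  have hn : ‖(⟨p, q⟩ : ℂ)‖ = 1 := by
    have : ‖(⟨p, q⟩ : ℂ)‖ ^ 2 = 1 := by
      rw [← Complex.normSq_eq_norm_sq, Complex.normSq_mk]
      linarith
    nlinarith [norm_nonneg (⟨p, q⟩ : ℂ)]
  have hc : cos (Complex.arg ⟨p, q⟩) = p := by
    simpa [hn] using Complex.norm_mul_cos_arg ⟨p, q⟩
  have hsn : sin (Complex.arg ⟨p, q⟩) = q := by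
    simpa [hn] using Complex.norm_mul_sin_arg ⟨p, q⟩
  refine ⟨Complex.arg ⟨p, q⟩, ?_, ?_⟩
  · rw [hc, hsn, ← e1]
    simp
  · rw [hc, hsn, ← e2, hs, hr]
    simp [sub_eq_add_neg]

/-- Invariance of `f` under the half turn about `ζ` in longitude is a `(ζ, π)`-symmetry. -/
lemma hasPiRotSym_of_polar (B : OrthonormalBasis (Fin 4) ℝ E4) (f : E4 → ℝ)
    (h : ∀ t α, f (polarPoint (B 0) (B 1, B 2) t (α + π)) =
      f (polarPoint (B 0) (B 1, B 2) t α)) : HasPiRotSym f (B 3) (B 0) := by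
  have hB : ∀ i j, ⟪B i, B j⟫ = if i = j then (1 : ℝ) else 0 :=
    orthonormal_iff_ite.1 B.orthonormal
  let K : Submodule ℝ E4 := Submodule.span ℝ {B 0, B 3}
  have hK : Module.finrank ℝ K = 2 := by
    have hli : LinearIndependent ℝ ![B 0, B 3] := by
      have e : ![B 0, B 3] = B ∘ ![0, 3] := by
        ext1 i
        fin_cases i <;> rfl
      rw [e]
      exact B.orthonormal.linearIndependent.comp ![0, 3] (by decide)
    have := finrank_span_eq_card hli
    rw [Matrix.range_cons_cons_empty] at this
    simpa [K] using this
  have hKo : Module.finrank ℝ Kᗮ = 2 := by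
    have := K.finrank_add_finrank_orthogonal
    rw [hK, finrank_euclideanSpace_fin] at this
    omega
  have hfix : ∀ x ∈ K, K.reflection x = x := fun x hx =>
    Submodule.reflection_mem_subspace_eq_self hx
  have hneg : ∀ v, ⟪v, B 3⟫ = 0 → ⟪v, B 0⟫ = 0 → K.reflection v = -v := by
    intro v h3 h0
    apply Submodule.reflection_mem_subspace_orthogonalComplement_eq_neg
    rw [Submodule.mem_orthogonal]
    intro u hu
    obtain ⟨c, d, rfl⟩ := Submodule.mem_span_pair.1 hu
    rw [inner_add_left, real_inner_smul_left, real_inner_smul_left, real_inner_comm, h0,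
      real_inner_comm, h3]
    simp
  have k0 : B 0 ∈ K := Submodule.subset_span (by simp)
  have k3 : B 3 ∈ K := Submodule.subset_span (by simp)
  refine ⟨K.reflection, ⟨⟨hfix _ k3, ?_⟩, hfix _ k0, ?_⟩, ?_⟩
  · have := K.det_reflection
    rw [hKo] at this
    simpa using this
  · intro v h3 h0
    rw [hneg v h3 h0]
    simp
  · intro θ hθ
    obtain ⟨t, α, rfl⟩ := exists_polarPoint B hθ
    rw [← h t α]
    congr 1
    simp only [polarPoint, map_add, map_smul, hfix _ k0,
      hneg (B 1) (by simp [hB]) (by simp [hB]), hneg (B 2) (by simp [hB]) (by simp [hB]),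
      cos_add_pi, sin_add_pi]
    module

lemma polarPoint_map (B : OrthonormalBasis (Fin 4) ℝ E4) (φ : E4 ≃ₗᵢ[ℝ] E4)
    (h0 : φ (B 0) = -B 0) {γ : ℝ} (h1 : φ (B 1) = cos γ • B 1 + sin γ • B 2)
    (h2 : φ (B 2) = sin γ • B 1 - cos γ • B 2) (t α : ℝ) :
    φ (polarPoint (B 0) (B 1, B 2) t α) = polarPoint (B 0) (B 1, B 2) (π - t) (γ - α) := by
  simp only [polarPoint, map_add, map_smul, h0, h1, h2, cos_pi_sub, sin_pi_sub, cos_sub γ, sin_sub γ]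
  module

/-- A frame rotated by `θ` inside its plane. -/
def rotFrame (p : E4 × E4) (θ : ℝ) : E4 × E4 :=
  (cos θ • p.1 + sin θ • p.2, -sin θ • p.1 + cos θ • p.2)

lemma polarPoint_rotFrame (ζ : E4) (p : E4 × E4) (θ t α : ℝ) :
    polarPoint ζ (rotFrame p θ) t α = polarPoint ζ p t (α + θ) := by
  simp only [polarPoint, rotFrame, cos_add, sin_add]
  module

lemma continuous_comp_polarPoint {ζ : E4} (hζ : ‖ζ‖ = 1) {h : E4 → ℝ} (hh : ContinuousOn h sph)
    {Y : Type*} [TopologicalSpace Y] {u : Y → frames ζ} {v w : Y → ℝ} (hu : Continuous u)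
    (hv : Continuous v) (hw : Continuous w) :
    Continuous fun y => h (polarPoint ζ (u y) (v y) (w y)) := by
  refine hh.comp_continuous (f := fun y => polarPoint ζ (u y) (v y) (w y)) ?_
    fun y => polarPoint_mem_sph hζ (u y).2 _ _
  have hu' : Continuous fun y => (u y : E4 × E4) := continuous_subtype_val.comp hu
  unfold polarPoint
  fun_prop

/-- If `f` has no `(ζ, π)`-symmetry on any `S²(w)`, then `f` and `g` cannot be related on every
`S²(w)`, `w ∈ S²(ζ)`, by a rotation sending `ζ` to `-ζ`: the axes of these rotations would yield
a nowhere vanishing section of a tensor power of the tangent bundle of `S²(ζ)`. -/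
lemma not_forall_exists_rot (ζ : E4) (hζ : ζ ∈ sph) (f g : E4 → ℝ)
    (hf : ContinuousOn f sph) (hg : ContinuousOn g sph)
    (hsym : ∀ w ∈ S2 ζ, ¬ HasPiRotSym f w ζ)
    (hPsi : ∀ w ∈ S2 ζ, ∃ φ : E4 ≃ₗᵢ[ℝ] E4,
      IsRot w φ ∧ φ ζ = -ζ ∧ ∀ θ ∈ S2 w, f (φ θ) = g θ) : False := by
  have hζ1 : ‖ζ‖ = 1 := by rwa [sph, mem_sphere_zero_iff_norm] at hζ
  have hB3 : ∀ B : OrthonormalBasis (Fin 4) ℝ E4, B 0 = ζ → B 3 ∈ S2 ζ := by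
    rintro B rfl
    refine ⟨by simp [sph], ?_⟩
    simp [orthonormal_iff_ite.1 B.orthonormal]
  have : CompactSpace (frames ζ) := isCompact_iff_compactSpace.1 (isCompact_frames ζ)
  let H : frames ζ → AddSubgroup ℝ := fun p =>
    { carrier := {δ | ∀ t α, f (polarPoint ζ p t (α + δ)) = f (polarPoint ζ p t α)}
      zero_mem' := by simp
      add_mem' := by
        intro x y hx hy t α
        rw [← add_assoc, hy, hx]
      neg_mem' := by
        intro x hx t α
        have := hx t (α + -x)
        rw [neg_add_cancel_right] at this
        exact this.symm }
  let Γ : frames ζ → Set ℝ := fun p =>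
    {γ | ∀ t α, f (polarPoint ζ p (π - t) (γ - α)) = g (polarPoint ζ p t α)}
  obtain ⟨N, hN0, hN⟩ := exists_uniform_period H (by
      have : {q : frames ζ × ℝ | q.2 ∈ H q.1} = ⋂ t, ⋂ α, {q : frames ζ × ℝ |
          f (polarPoint ζ q.1 t (α + q.2)) = f (polarPoint ζ q.1 t α)} := by
        ext q
        simp [H, ← SetLike.mem_coe]
      rw [this]
      exact isClosed_iInter fun t => isClosed_iInter fun α => isClosed_eq
        (continuous_comp_polarPoint hζ1 hf (by fun_prop) (by fun_prop) (by fun_prop))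
        (continuous_comp_polarPoint hζ1 hf (by fun_prop) (by fun_prop) (by fun_prop)))
    (by
      intro p t α
      simp only [polarPoint, cos_add_two_pi, sin_add_two_pi])
    (by
      intro p hp
      obtain ⟨B, hb0, hb1, hb2⟩ := exists_basis hζ1 p.2
      refine hsym (B 3) (hB3 B hb0) ?_
      rw [← hb0]
      refine hasPiRotSym_of_polar B f ?_
      rw [hb0, hb1, hb2]
      exact hp)
  have hne : ∀ p, (Γ p).Nonempty := by
    intro p
    obtain ⟨B, hb0, hb1, hb2⟩ := exists_basis hζ1 p.2
    obtain ⟨φ, hφ, hφζ, hfg⟩ := hPsi (B 3) (hB3 B hb0)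
    rw [← hb0] at hφζ
    obtain ⟨γ, h1, h2⟩ := exists_angle_of_isRot B φ hφ hφζ
    refine ⟨γ, fun t α => ?_⟩
    have hp : ((p : E4 × E4)) = (B 1, B 2) := by rw [hb1, hb2]
    have hmem : polarPoint ζ p t α ∈ S2 (B 3) := by
      refine ⟨polarPoint_mem_sph hζ1 p.2 t α, ?_⟩
      rw [hp, ← hb0]
      simp [polarPoint, inner_add_left, real_inner_smul_left,
        orthonormal_iff_ite.1 B.orthonormal]
    rw [← hfg _ hmem, hp, ← hb0, polarPoint_map B φ hφζ h1 h2]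
  obtain ⟨Z, hZc, hZ⟩ := exists_continuous_power Γ (by
      have : {q : frames ζ × ℝ | q.2 ∈ Γ q.1} = ⋂ t, ⋂ α, {q : frames ζ × ℝ |
          f (polarPoint ζ q.1 (π - t) (q.2 - α)) = g (polarPoint ζ q.1 t α)} := by
        ext q
        simp [Γ]
      rw [this]
      exact isClosed_iInter fun t => isClosed_iInter fun α => isClosed_eq
        (continuous_comp_polarPoint hζ1 hf (by fun_prop) (by fun_prop) (by fun_prop))
        (continuous_comp_polarPoint hζ1 hg (by fun_prop) (by fun_prop) (by fun_prop)))
    hne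
    (by
      intro p γ hγ k t α
      rw [← hγ t α]
      have : γ + k * (2 * π) - α = γ - α + k * (2 * π) := by ring
      simp only [polarPoint, this, cos_add_int_mul_two_pi, sin_add_int_mul_two_pi])
    N
    (by
      intro p γ hγ γ' hγ'
      refine hN p _ fun t α => ?_
      have e := hγ (π - t) (γ' - α)
      rw [← hγ' (π - t) (γ' - α)] at e
      rw [sub_sub_cancel, sub_sub_cancel] at e
      rw [← e]
      congr 2
      ring)
  have hrot : ∀ p q : frames ζ, ∀ θ, (q : E4 × E4) = rotFrame p θ →
      Z q = Z p * Circle.exp (-(N * 2 * θ)) := by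
    intro p q θ hq
    obtain ⟨γ, hγ⟩ := hne q
    have hγ' : γ + 2 * θ ∈ Γ p := by
      intro t α
      have := hγ t (α - θ)
      rw [hq, polarPoint_rotFrame, polarPoint_rotFrame, sub_add_cancel] at this
      rw [← this]
      congr 2
      ring
    rw [hZ q γ hγ, hZ p _ hγ', ← Circle.exp_add]
    congr 1
    ring
  obtain ⟨B, hB⟩ := Orthonormal.exists_orthonormalBasis_extension_of_card_eq (𝕜 := ℝ) (E := E4)
    (ι := Fin 4) (by simp) (v := fun _ => ζ) (s := {0})
    ⟨fun _ => hζ1, fun i j hij => absurd (Subsingleton.elim i j) hij⟩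
  have hb0 : B 0 = ζ := hB 0 rfl
  let c : ℝ × ℝ → E4 × E4 := fun x =>
    (cos x.1 • (cos x.2 • B 1 + sin x.2 • B 2) - sin x.1 • B 3,
      -sin x.2 • B 1 + cos x.2 • B 2)
  have hin : ∀ i j, ⟪B i, B j⟫ = if i = j then (1 : ℝ) else 0 :=
    orthonormal_iff_ite.1 B.orthonormal
  have hunit : ∀ v : E4, ⟪v, v⟫ = 1 → ‖v‖ = 1 := by
    intro v hv
    rw [real_inner_self_eq_norm_sq] at hv
    nlinarith [norm_nonneg v]
  have hc : ∀ x, c x ∈ frames ζ := by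
    intro x
    refine ⟨hunit _ ?_, hunit _ ?_, ?_, ?_, ?_⟩ <;>
      simp only [c, ← hb0, inner_add_left, inner_add_right, inner_sub_left, inner_sub_right,
        real_inner_smul_left, real_inner_smul_right, hin] <;> simp
    · linear_combination sin_sq_add_cos_sq x.1 + cos x.1 ^ 2 * sin_sq_add_cos_sq x.2
    · linear_combination sin_sq_add_cos_sq x.2
    · ring
  have hcc : Continuous c := by fun_prop
  refine no_homotopy_of_opposite_winding (fun x => Z ⟨c x, hc x⟩)
    (hZc.comp (hcc.subtype_mk hc)) (fun s => ?_) (N * 2) (by positivity)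
    (fun θ => hrot _ _ θ ?_) (fun θ => ?_)
  · simp [c]
  · simp [c, rotFrame]
  · refine (hrot ⟨c (π, 0), hc _⟩ ⟨c (π, θ), hc _⟩ (-θ) ?_).trans ?_
    · simp [c, rotFrame]
    · simp

/-- Lemma: uniqueness of the rotation when `S²(ζ) = Ψ`. -/
theorem stmt_9 (ζ : E4) (hζ : ζ ∈ sph) (f g : E4 → ℝ)
    (hf : ContinuousOn f sph) (hg : ContinuousOn g sph)
    (hfodd : ∀ θ ∈ sph, f (Ocal ζ θ) = - f θ)
    (hgodd : ∀ θ ∈ sph, g (Ocal ζ θ) = - g θ)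
    (hsym : ∀ w ∈ S2 ζ,
      (¬ HasPiRotSym f w ζ ∧ ¬ HasPiRotSym g w ζ) ∧
      ∀ u ∈ S2 ζ ∩ S2 w, ¬ HasPiRotSym f w u ∧ ¬ HasPiRotSym g w u)
    (hPsi : ∀ w ∈ S2 ζ, ∃ φ : E4 ≃ₗᵢ[ℝ] E4,
      IsRot w φ ∧ φ ζ = -ζ ∧ ∀ θ ∈ S2 w, f (φ θ) = g θ) :
    ∀ w ∈ S2 ζ,
      (∃! φ : E4 ≃ₗᵢ[ℝ] E4, IsRot w φ ∧ φ ζ = -ζ ∧ ∀ θ ∈ S2 w, f (φ θ) = g θ) ∧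
      (∀ φ : E4 ≃ₗᵢ[ℝ] E4, IsRot w φ → φ ζ = -ζ → (∀ θ ∈ S2 w, f (φ θ) = g θ) →
        ∃ u ∈ S2 w ∩ S2 ζ, IsRotAngleAbout w u 1 φ) := by
  exact (not_forall_exists_rot ζ hζ f g hf hg (fun w hw => (hsym w hw).1.1) hPsi).elim
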